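/- Let n ≥ 2 and let σ be a cycle of length n on ℤ/nℤ whose orbit under T (conjugation by the rotation a ↦ a+1) has size h. Then h·(des̄(σ) − 1) ≡ 0 (mod n). -/

import Mathlib

open Finset Polynomial

/-- The representative in `{1,…,n}` of a residue class `a : ZMod n`. -/
def zrep (n : ℕ) (a : ZMod n) : ℕ := if a.val = 0 then n else a.val

/-- The major index of a permutation of `{1,…,n}` (identified with `ZMod n`). -/
def maj (n : ℕ) (σ : Equiv.Perm (ZMod n)) : ℕ :=
  ∑ i ∈ Finset.Icc 1 (n - 1),
    if zrep n (σ ((i : ZMod n) + 1)) < zrep n (σ (i : ZMod n)) then i else 0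

/-- The cyclic major index. -/
def majbar (n : ℕ) (σ : Equiv.Perm (ZMod n)) : ℕ :=
  ∑ i ∈ Finset.Icc 1 n,
    if zrep n (σ ((i : ZMod n) + 1)) < zrep n (σ (i : ZMod n)) then i else 0

/-- The cyclic descent number. -/
def desbar (n : ℕ) (σ : Equiv.Perm (ZMod n)) : ℕ :=
  ((Finset.Icc 1 n).filter
    (fun i : ℕ => zrep n (σ (((i : ℕ) : ZMod n) + 1)) < zrep n (σ ((i : ℕ) : ZMod n)))).card

/-- Conjugation by the rotation `a ↦ a + 1`. -/
def Tmap (n : ℕ) (σ : Equiv.Perm (ZMod n)) : Equiv.Perm (ZMod n) :=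
  Equiv.addRight (1 : ZMod n) * σ * (Equiv.addRight (1 : ZMod n))⁻¹

theorem zrep_cast (n : ℕ) [NeZero n] (a : ZMod n) : ((zrep n a : ℕ) : ZMod n) = a := by
  unfold zrep
  split_ifs with h
  · rw [ZMod.natCast_self, (ZMod.val_eq_zero a).1 h]
  · exact ZMod.natCast_zmod_val a

theorem zrep_pos (n : ℕ) [NeZero n] (a : ZMod n) : 1 ≤ zrep n a := by
  have := NeZero.pos n
  unfold zrep
  split_ifs with h <;> omega

theorem zrep_le (n : ℕ) [NeZero n] (a : ZMod n) : zrep n a ≤ n := by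
  have := ZMod.val_lt a
  unfold zrep
  split_ifs with h <;> omega

/-- Going from the representative of `a` up to that of `b`, with a wrap-around at each descent,
covers the cyclic distance from `a` to `b`. -/
theorem val_sub_eq_zrep_sub (n : ℕ) [NeZero n] (a b : ZMod n) :
    ((b - a).val : ℤ) =
      (zrep n b : ℤ) - zrep n a + n * (if zrep n b < zrep n a then 1 else 0) := by
  have ha := zrep_pos n a
  have ha' := zrep_le n a
  have hb := zrep_pos n b
  have hb' := zrep_le n b
  have key : b - a = (((zrep n b : ℤ) - zrep n a +
      n * (if zrep n b < zrep n a then 1 else 0) : ℤ) : ZMod n) := by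
    push_cast
    rw [zrep_cast, zrep_cast, ZMod.natCast_self]
    ring
  conv_lhs => rw [key]
  rw [ZMod.val_intCast]
  apply Int.emod_eq_of_lt <;> split_ifs <;> omega

theorem Tmap_iterate_apply (n : ℕ) (σ : Equiv.Perm (ZMod n)) (k : ℕ) (a : ZMod n) :
    (Tmap n)^[k] σ (a + k) = σ a + k := by
  induction k generalizing a with
  | zero => simp
  | succ k ih =>
    rw [Function.iterate_succ_apply', Nat.cast_succ, ← add_assoc, ← add_assoc, ← ih a]
    simp [Tmap]

theorem isPeriodicPt_Tmap (n : ℕ) (σ : Equiv.Perm (ZMod n)) :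
    Function.IsPeriodicPt (Tmap n) n σ := by
  refine Equiv.ext fun a => ?_
  simpa using Tmap_iterate_apply n σ n a

/-- The forward orbit of a periodic point has as many elements as its minimal period. -/
theorem ncard_forward_orbit {α : Type*} (f : α → α) (x : α) (hx : x ∈ Function.periodicPts f) :
    Set.ncard {y | ∃ k : ℕ, f^[k] x = y} = Function.minimalPeriod f x := by
  have himage : {y | ∃ k : ℕ, f^[k] x = y} =
      (fun k => f^[k] x) '' Set.Iio (Function.minimalPeriod f x) := by
    ext y
    constructor
    · rintro ⟨k, rfl⟩
      exact ⟨k % Function.minimalPeriod f x,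
        Nat.mod_lt _ (Function.minimalPeriod_pos_of_mem_periodicPts hx),
        Function.iterate_mod_minimalPeriod_eq⟩
    · rintro ⟨k, -, rfl⟩
      exact ⟨k, rfl⟩
  rw [himage, Function.iterate_injOn_Iio_minimalPeriod.ncard_image,
    ← Finset.coe_Iio, Set.ncard_coe_finset, Nat.card_Iio]

theorem sum_range_mul_of_periodic (f : ℕ → ℤ) (h q : ℕ) (hf : ∀ i, f (i + h) = f i) :
    ∑ i ∈ range (h * q), f i = q * ∑ i ∈ range h, f i := by
  have hper : Function.Periodic f h := hf
  induction q with
  | zero => simp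
  | succ q ih =>
    have hshift : ∀ i, f (h * q + i) = f i := fun i => by
      rw [add_comm, mul_comm]
      exact hper.nat_mul q i
    rw [Nat.mul_succ, Finset.sum_range_add, ih]
    simp only [hshift]
    push_cast
    ring

/-- The cyclic distances between consecutive values of `σ` add up to `n` times the cyclic descent
number. -/
theorem sum_val_sub_eq (n : ℕ) [NeZero n] (σ : Equiv.Perm (ZMod n)) :
    ∑ i ∈ range n, ((σ (((i + 1 : ℕ) : ZMod n) + 1) - σ ((i + 1 : ℕ) : ZMod n)).val : ℤ) =
      n * desbar n σ := by
  have htel := Finset.sum_range_sub (fun i : ℕ => (zrep n (σ ((i + 1 : ℕ) : ZMod n)) : ℤ)) n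
  have hend : ((n + 1 : ℕ) : ZMod n) = ((0 + 1 : ℕ) : ZMod n) := by simp
  rw [hend, sub_self] at htel
  have hdes : (desbar n σ : ℤ) = ∑ i ∈ range n,
      if zrep n (σ (((i + 1 : ℕ) : ZMod n) + 1)) < zrep n (σ ((i + 1 : ℕ) : ZMod n))
        then (1 : ℤ) else 0 := by
    unfold desbar
    rw [Finset.card_filter, Nat.cast_sum, ← Finset.Ico_add_one_right_eq_Icc,
      Finset.sum_Ico_eq_sum_range]
    simp [add_comm]
  simp only [val_sub_eq_zrep_sub]
  rw [Finset.sum_add_distrib, ← Finset.mul_sum, ← hdes]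
  simp only [Nat.cast_succ] at htel ⊢
  rw [htel, zero_add]

/-- if the T-orbit of an n-cycle σ has size h, then
`h·(des̄(σ) - 1) ≡ 0 (mod n)`. -/
theorem orbit_card_mul_desbar (n : ℕ) [NeZero n] (hn : 2 ≤ n) (σ : Equiv.Perm (ZMod n))
    (hc : σ.IsCycle) (hs : σ.support.card = n) (h : ℕ)
    (hh : h = Set.ncard {ρ : Equiv.Perm (ZMod n) | ∃ k : ℕ, (Tmap n)^[k] σ = ρ}) :
    (h : ℤ) * ((desbar n σ : ℤ) - 1) ≡ 0 [ZMOD (n : ℤ)] := by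
  have hper := isPeriodicPt_Tmap n σ
  rw [ncard_forward_orbit _ _ (Function.mk_mem_periodicPts (NeZero.pos n) hper)] at hh
  have hσ : ∀ a, σ (a + h) = σ a + h := fun a => by
    have hfix : (Tmap n)^[h] σ = σ := by rw [hh]; exact Function.iterate_minimalPeriod
    simpa only [hfix] using Tmap_iterate_apply n σ h a
  obtain ⟨q, hq⟩ : h ∣ n := hh ▸ hper.minimalPeriod_dvd
  set d : ℕ → ℤ := fun i =>
    ((σ (((i + 1 : ℕ) : ZMod n) + 1) - σ ((i + 1 : ℕ) : ZMod n)).val : ℤ) with hd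
  have hdper : ∀ i, d (i + h) = d i := fun i => by
    have hi : ((i + h + 1 : ℕ) : ZMod n) = ((i + 1 : ℕ) : ZMod n) + h := by push_cast; ring
    simp only [hd]
    rw [hi, add_right_comm, hσ, hσ, add_sub_add_right_eq_sub]
  have hsum : ∑ i ∈ range (h * q), d i = n * desbar n σ := by
    rw [← hq]
    exact sum_val_sub_eq n σ
  rw [sum_range_mul_of_periodic d h q hdper] at hsum
  have hq0 : (q : ℤ) ≠ 0 := by
    intro h0
    have := NeZero.ne n
    simp_all
  have hS : ∑ i ∈ range h, d i = h * desbar n σ := by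
    apply mul_left_cancel₀ hq0
    have hqz : (n : ℤ) = h * q := by exact_mod_cast hq
    rw [hsum, hqz]
    ring
  have hmod : ((∑ i ∈ range h, d i : ℤ) : ZMod n) = h := by
    have htel := Finset.sum_range_sub (fun i : ℕ => σ ((i + 1 : ℕ) : ZMod n)) h
    have hend : ((h + 1 : ℕ) : ZMod n) = ((0 + 1 : ℕ) : ZMod n) + h := by push_cast; ring
    rw [hend, hσ, add_sub_cancel_left] at htel
    rw [← htel]
    simp [hd]
  rw [← ZMod.intCast_eq_intCast_iff, mul_sub, ← hS]
  push_cast at hmod ⊢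
  rw [hmod]
  ring
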